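/- If A is a Gorenstein noetherian local ring, then there exists a test module for A of finite Gorenstein dimension; in particular, the residue field k is such a module. -/

import Mathlib

open CategoryTheory IsLocalRing

universe u

/-! ## Homological dimensions -/

/-- Flat dimension at most `n`: `M` is flat, or there is a surjection from a flat
module whose kernel has flat dimension at most `n - 1`. -/
def FlatDimLE (A : Type u) [CommRing A] :
    ℕ → ∀ (M : Type u) [AddCommGroup M] [Module A M], Prop
  | 0 => fun M _ _ => Module.Flat A M
  | n + 1 => fun M _ _ =>
      ∃ (F : Type u) (_ : AddCommGroup F) (_ : Module A F), Module.Flat A F ∧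
        ∃ f : F →ₗ[A] M, Function.Surjective f ∧ FlatDimLE A n (LinearMap.ker f)

/-- Projective dimension at most `n`. -/
def ProjDimLE (A : Type u) [CommRing A] :
    ℕ → ∀ (M : Type u) [AddCommGroup M] [Module A M], Prop
  | 0 => fun M _ _ => Module.Projective A M
  | n + 1 => fun M _ _ =>
      ∃ (P : Type u) (_ : AddCommGroup P) (_ : Module A P), Module.Projective A P ∧
        ∃ f : P →ₗ[A] M, Function.Surjective f ∧ ProjDimLE A n (LinearMap.ker f)

/-- Injective dimension at most `n`. -/
def InjDimLE (A : Type u) [CommRing A] :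
    ℕ → ∀ (M : Type u) [AddCommGroup M] [Module A M], Prop
  | 0 => fun M _ _ => Module.Injective A M
  | n + 1 => fun M _ _ =>
      ∃ (I : Type u) (_ : AddCommGroup I) (_ : Module A I), Module.Injective A I ∧
        ∃ f : M →ₗ[A] I, Function.Injective f ∧ InjDimLE A n (I ⧸ LinearMap.range f)

/-! ## Classes of local rings -/

/-- A Gorenstein (noetherian) local ring: a noetherian local ring having finite injective
dimension as a module over itself. -/
def IsGorensteinLocalRing (A : Type u) [CommRing A] : Prop :=
  IsNoetherianRing A ∧ IsLocalRing A ∧ ∃ n : ℕ, InjDimLE A n A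

/-- A regular local ring: a noetherian local ring whose maximal ideal is generated by
`dim A` elements. -/
def IsRegularLocal (A : Type u) [CommRing A] : Prop :=
  IsNoetherianRing A ∧ IsLocalRing A ∧
    ∃ s : Finset A, (Ideal.span (s : Set A)).IsMaximal ∧
      (s.card : WithBot ℕ∞) = ringKrullDim A

/-- A deformation: a surjective ring homomorphism whose kernel is generated by a
regular sequence. -/
def IsDeformation {Q A' : Type u} [CommRing Q] [CommRing A'] (f : Q →+* A') : Prop :=
  Function.Surjective f ∧
    ∃ rs : List Q, RingTheory.Sequence.IsRegular Q rs ∧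
      RingHom.ker f = Ideal.span {x | x ∈ rs}

/-- A noetherian local ring is complete intersection if its `m`-adic completion is a
quotient of a regular local ring by an ideal generated by a regular sequence. -/
def IsCompleteIntersectionLocalRing (A : Type u) [CommRing A] [IsLocalRing A] : Prop :=
  ∃ (Q : Type u) (_ : CommRing Q), IsRegularLocal Q ∧
    ∃ f : Q →+* AdicCompletion (maximalIdeal A) A, IsDeformation f

/-! ## Tor, test modules -/

/-- Vanishing of `Tor_i^A(M, N)`. -/
def TorVanish (A : Type u) [CommRing A] (i : ℕ)
    (M : Type u) [AddCommGroup M] [Module A M]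
    (N : Type u) [AddCommGroup N] [Module A N] : Prop :=
  Subsingleton (((Tor (ModuleCat.{u} A) i).obj (ModuleCat.of A M)).obj (ModuleCat.of A N))

/-- `M` is a test module for `A`: for every local homomorphism `A → B` of noetherian local
rings and every finitely generated `B`-module `N`, vanishing of `Tor_i^A(M,N)` for all
`i ≫ 0` implies that `N` has finite flat dimension over `A`. -/
def IsTestModule (A : Type u) [CommRing A] [IsLocalRing A] [IsNoetherianRing A]
    (M : Type u) [AddCommGroup M] [Module A M] : Prop :=
  ∀ (B : Type u) [CommRing B] [IsLocalRing B] [IsNoetherianRing B] [Algebra A B],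
    IsLocalHom (algebraMap A B) →
    ∀ (N : Type u) [AddCommGroup N] [Module A N] [Module B N] [IsScalarTower A B N],
      Module.Finite B N →
      (∃ i₀ : ℕ, ∀ i ≥ i₀, TorVanish A i M N) →
      ∃ n : ℕ, FlatDimLE A n N

/-- `M` is a Test module for `A`: for every finitely generated `A`-module `N`, vanishing of
`Tor_i^A(M,N)` for all `i ≫ 0` implies that `N` has finite flat dimension over `A`. -/
def IsCapitalTestModule (A : Type u) [CommRing A] [IsLocalRing A] [IsNoetherianRing A]
    (M : Type u) [AddCommGroup M] [Module A M] : Prop :=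
  ∀ (N : Type u) [AddCommGroup N] [Module A N], Module.Finite A N →
    (∃ i₀ : ℕ, ∀ i ≥ i₀, TorVanish A i M N) →
    ∃ n : ℕ, FlatDimLE A n N

/-! ## Weakly regular homomorphisms and upper CI dimension -/

/-- `A → A'` (given as an algebra) is a weakly regular local homomorphism: it is a local
homomorphism, flat, and the closed fiber `A' ⊗_A k = A'/m A'` is a regular local ring. -/
def IsWeaklyRegularAlgebra (A : Type u) [CommRing A] [IsLocalRing A]
    (A' : Type u) [CommRing A'] [Algebra A A'] : Prop :=
  IsLocalHom (algebraMap A A') ∧ Module.Flat A A' ∧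
    IsRegularLocal (A' ⧸ Ideal.map (algebraMap A A') (maximalIdeal A))

/-- `M` has finite upper complete intersection dimension `CI*-dim_A(M) < ∞`: there are a
weakly regular homomorphism `A → A'` of noetherian local rings and a deformation `Q → A'`
such that `pd_Q (A' ⊗_A M) < ∞`. -/
def CIStarDimFinite (A : Type u) [CommRing A] [IsLocalRing A]
    (M : Type u) [AddCommGroup M] [Module A M] : Prop :=
  ∃ (A' : Type u) (_ : CommRing A') (_ : IsLocalRing A') (_ : IsNoetherianRing A')
    (_ : Algebra A A'), IsWeaklyRegularAlgebra A A' ∧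
    ∃ (Q : Type u) (_ : CommRing Q) (_ : IsLocalRing Q) (_ : IsNoetherianRing Q)
      (f : Q →+* A'), IsDeformation f ∧
        ∃ n : ℕ,
          let _inst : Module Q (TensorProduct A A' M) :=
            Module.compHom (TensorProduct A A' M) f
          ProjDimLE Q n (TensorProduct A A' M)

/-! ## Gorenstein dimension -/

/-- Vanishing of `Ext^i_A(M, N)`. -/
def ExtVanish (A : Type u) [CommRing A] (i : ℕ)
    (M : Type u) [AddCommGroup M] [Module A M]
    (N : Type u) [AddCommGroup N] [Module A N] : Prop :=
  Subsingleton (((Ext A (ModuleCat.{u} A) i).obj (Opposite.op (ModuleCat.of A M))).obj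
    (ModuleCat.of A N))

/-- `G-dim_A M = 0`: the biduality map is an isomorphism and
`Ext^i(M, A) = 0 = Ext^i(M*, A)` for `i > 0`. -/
def GDimZero (A : Type u) [CommRing A] (M : Type u) [AddCommGroup M] [Module A M] : Prop :=
  Function.Bijective (Module.Dual.eval A M) ∧
    (∀ i > 0, ExtVanish A i M A) ∧
    (∀ i > 0, ExtVanish A i (Module.Dual A M) A)

/-- `G-dim_A M ≤ n`: `M` admits a resolution of length `n` by modules of G-dimension `0`. -/
def GDimLE (A : Type u) [CommRing A] :
    ℕ → ∀ (M : Type u) [AddCommGroup M] [Module A M], Prop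
  | 0 => fun M _ _ => GDimZero A M
  | n + 1 => fun M _ _ =>
      ∃ (T : Type u) (_ : AddCommGroup T) (_ : Module A T), GDimZero A T ∧
        ∃ f : T →ₗ[A] M, Function.Surjective f ∧ GDimLE A n (LinearMap.ker f)

/-! ## Complexity -/

/-- The length of a module: the length of the longest chain in its lattice of submodules.
For a module annihilated by the maximal ideal (such as `Tor_n^A(M, k)`) this is its
dimension as a `k`-vector space. -/
noncomputable def moduleLength (A : Type u) [CommRing A]
    (M : Type u) [AddCommGroup M] [Module A M] : WithBot ℕ∞ :=
  Order.krullDim (Submodule A M)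

/-- `cx_A(M) ≤ c`: there exists a real `α` with
`dim_k Tor_n^A(M, k) ≤ α n^(c-1)` for all `n ≫ 0`. -/
def ComplexityLE (A : Type u) [CommRing A] [IsLocalRing A]
    (M : Type u) [AddCommGroup M] [Module A M] (c : ℕ) : Prop :=
  ∃ α : ℝ, ∃ n₀ : ℕ, ∀ n ≥ n₀, ∃ d : ℕ,
    moduleLength A
      (((Tor (ModuleCat.{u} A) n).obj (ModuleCat.of A M)).obj
        (ModuleCat.of A (ResidueField A))) = (d : ℕ∞) ∧
      (d : ℝ) ≤ α * (n : ℝ) ^ ((c : ℤ) - 1)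

/-- The complexity `cx_A(M)`: the least `c` as above. -/
noncomputable def complexity (A : Type u) [CommRing A] [IsLocalRing A]
    (M : Type u) [AddCommGroup M] [Module A M] : ℕ :=
  sInf {c : ℕ | ComplexityLE A M c}

/-- The embedding dimension `dim_k m/m²` of a local ring. -/
noncomputable def embDim (A : Type u) [CommRing A] [IsLocalRing A] : ℕ :=
  Module.finrank (ResidueField A) (CotangentSpace A)

section GDimPart

lemma gd_shortExact {A : Type u} [CommRing A] {M₁ M₂ M₃ : Type u} [AddCommGroup M₁]
    [AddCommGroup M₂] [AddCommGroup M₃] [Module A M₁] [Module A M₂] [Module A M₃]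
    (g : M₁ →ₗ[A] M₂) (f : M₂ →ₗ[A] M₃) (hg : Function.Injective g) (hf : Function.Surjective f)
    (h : Function.Exact g f) :
    (ModuleCat.shortComplexOfCompEqZero g f h.linearMap_comp_eq_zero).ShortExact :=
  ModuleCat.shortComplex_shortExact _ h hg hf

/-- Vanishing of `Ext^i(M, A)` for the derived category `Ext`. -/
def AEVan (A : Type u) [CommRing A] (M : Type u) [AddCommGroup M] [Module A M] (i : ℕ) : Prop :=
  ∀ x : Abelian.Ext.{u} (ModuleCat.of A M) (ModuleCat.of A A) i, x = 0

lemma extVanish_of_AEVan (A : Type u) [CommRing A] (M : Type u) [AddCommGroup M] [Module A M]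
    (i : ℕ) (h : AEVan A M (i + 1)) : ExtVanish A (i + 1) M A := by
  unfold ExtVanish
  let P := projectiveResolution (ModuleCat.of A M)
  rw [(P.isoExt (R := A) (i + 1) (ModuleCat.of A A)).toLinearEquiv.toEquiv.subsingleton_congr]
  rw [← ModuleCat.isZero_iff_subsingleton, ← HomologicalComplex.exactAt_iff_isZero_homology,
    HomologicalComplex.exactAt_iff' _ i (i + 1) (i + 2) (by simp) (by simp),
    ShortComplex.moduleCat_exact_iff]
  intro (x : P.complex.X (i + 1) ⟶ ModuleCat.of A A) hx
  have hx' : P.complex.d (i + 2) (i + 1) ≫ x = 0 := hx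
  obtain ⟨y, hy⟩ := (P.extMk_eq_zero_iff x (i + 2) rfl hx' i rfl).1 (h _)
  exact ⟨y, hy⟩

lemma AEVan_of_projective (A : Type u) [CommRing A] (M : Type u) [AddCommGroup M] [Module A M]
    [Module.Projective A M] (i : ℕ) : AEVan A M (i + 1) := by
  intro x
  have : Projective (ModuleCat.of A M) := (IsProjective.iff_projective M).1 inferInstance
  exact x.eq_zero_of_projective

section
variable {A : Type u} [CommRing A] {M₁ M₂ M₃ : Type u} [AddCommGroup M₁]
    [AddCommGroup M₂] [AddCommGroup M₃] [Module A M₁] [Module A M₂] [Module A M₃]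

lemma AEVan_ker
    (g : M₁ →ₗ[A] M₂) (f : M₂ →ₗ[A] M₃) (hg : Function.Injective g) (hf : Function.Surjective f)
    (h : Function.Exact g f)
    (i : ℕ) (h₃ : AEVan A M₃ (i + 1)) (h₂ : AEVan A M₂ i) : AEVan A M₁ i := by
  intro x
  obtain ⟨y, hy⟩ := Abelian.Ext.contravariant_sequence_exact₁ (gd_shortExact g f hg hf h)
    (ModuleCat.of A A) x (add_comm 1 i) (h₃ _)
  rw [← hy, h₂ y, Abelian.Ext.comp_zero]

lemma AEVan_coker
    (g : M₁ →ₗ[A] M₂) (f : M₂ →ₗ[A] M₃) (hg : Function.Injective g) (hf : Function.Surjective f)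
    (h : Function.Exact g f)
    (i : ℕ) (h₁ : AEVan A M₁ i) (h₂ : AEVan A M₂ (i + 1)) : AEVan A M₃ (i + 1) := by
  intro x
  obtain ⟨y, hy⟩ := Abelian.Ext.contravariant_sequence_exact₃ (gd_shortExact g f hg hf h)
    (ModuleCat.of A A) x (h₂ _) (add_comm 1 i)
  rw [← hy, h₁ y, Abelian.Ext.comp_zero]

lemma AEVan_extend
    (g : M₁ →ₗ[A] M₂) (f : M₂ →ₗ[A] M₃) (hg : Function.Injective g) (hf : Function.Surjective f)
    (h : Function.Exact g f)
    (h₃ : AEVan A M₃ 1) (φ : M₁ →ₗ[A] A) : ∃ ψ : M₂ →ₗ[A] A, ψ ∘ₗ g = φ := by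
  obtain ⟨y, hy⟩ := Abelian.Ext.contravariant_sequence_exact₁ (gd_shortExact g f hg hf h)
    (ModuleCat.of A A) (Abelian.Ext.mk₀ (ModuleCat.ofHom φ)) (add_comm 1 0) (h₃ _)
  obtain ⟨ψ, rfl⟩ := Abelian.Ext.mk₀_bijective _ _ |>.2 y
  rw [Abelian.Ext.mk₀_comp_mk₀] at hy
  have := (Abelian.Ext.mk₀_bijective _ _).1 hy
  exact ⟨ψ.hom, congrArg ModuleCat.Hom.hom this⟩
end

lemma hasInj_of_InjDimLE (A : Type u) [CommRing A] (n : ℕ) :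
    ∀ (M : Type u) [AddCommGroup M] [Module A M], InjDimLE A n M →
      HasInjectiveDimensionLT (ModuleCat.of A M) (n + 1) := by
  induction n with
  | zero =>
    intro M _ _ h
    have h : Module.Injective A M := h
    have : Injective (ModuleCat.of A M) := (Module.injective_iff_injective_object A M).1 h
    infer_instance
  | succ n ih =>
    intro M _ _ h
    obtain ⟨I, _, _, hI, f, hf, h⟩ := h
    have : Injective (ModuleCat.of A I) := (Module.injective_iff_injective_object A I).1 hI
    exact (gd_shortExact f (LinearMap.range f).mkQ hf (Submodule.mkQ_surjective _)
      f.exact_map_mkQ_range).hasInjectiveDimensionLT_X₁ (n + 1) (ih _ h)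
      (hasInjectiveDimensionLT_of_ge (ModuleCat.of A I) 1 (n + 2) (by lia))

section
variable {A : Type u} [CommRing A] [IsNoetherianRing A] 

/-- All `Ext^i(M, A)`, `i > 0`, vanish. -/
def AEAll (A : Type u) [CommRing A] (M : Type u) [AddCommGroup M] [Module A M] : Prop :=
  ∀ i, AEVan A M (i + 1)

lemma AEAll_ker {M F : Type u} [AddCommGroup M] [AddCommGroup F] [Module A M] [Module A F]
    [Module.Projective A F] (f : F →ₗ[A] M) (hf : Function.Surjective f) (h : AEAll A M) :
    AEAll A (LinearMap.ker f) := fun i =>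
  AEVan_ker (LinearMap.ker f).subtype f (Submodule.subtype_injective _) hf
    (LinearMap.exact_subtype_ker_map f) (i + 1) (h _) (AEVan_of_projective A F i)

lemma dual_exact {M F : Type u} [AddCommGroup M] [AddCommGroup F] [Module A M] [Module A F]
    (f : F →ₗ[A] M) (hf : Function.Surjective f) (h : AEAll A M) :
    Function.Injective f.dualMap ∧ Function.Surjective (LinearMap.ker f).subtype.dualMap ∧
      Function.Exact f.dualMap (LinearMap.ker f).subtype.dualMap := by
  refine ⟨LinearMap.dualMap_injective_of_surjective hf, fun φ => ?_, fun φ => ⟨fun hφ => ?_, ?_⟩⟩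
  · exact AEVan_extend (LinearMap.ker f).subtype f (Submodule.subtype_injective _) hf
      (LinearMap.exact_subtype_ker_map f) (h 0) φ
  · have hk : LinearMap.ker f ≤ LinearMap.ker φ := fun x hx => by
      simpa using LinearMap.congr_fun hφ ⟨x, hx⟩
    refine ⟨(LinearMap.ker f).liftQ φ hk ∘ₗ (f.quotKerEquivOfSurjective hf).symm, ?_⟩
    ext x
    have : (f.quotKerEquivOfSurjective hf).symm (f x) = Submodule.Quotient.mk x := by
      rw [LinearEquiv.symm_apply_eq]; rfl
    simp [this]
  · rintro ⟨ψ, rfl⟩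
    ext x
    simp

lemma AEVan_dual_of_ge (n : ℕ) (hn : ∀ (M : Type u) [AddCommGroup M] [Module A M] (i : ℕ),
    n ≤ i → AEVan A M (i + 1)) (k : ℕ) : ∀ (i : ℕ) (_ : n ≤ i + k) (M : Type u) [AddCommGroup M]
      [Module A M] [Module.Finite A M], AEAll A M → AEVan A (Module.Dual A M) (i + 1) := by
  induction k with
  | zero => intro i hi M _ _ _ _; exact hn _ _ hi
  | succ k ih =>
    intro i hi M _ _ _ h
    obtain ⟨m, f, hf⟩ := Module.Finite.exists_fin' A M
    let e : ULift.{u} (Fin m) ≃ Fin m := Equiv.ulift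
    obtain ⟨h1, h2, h3⟩ := dual_exact f hf h
    exact AEVan_ker _ _ h1 h2 h3 (i + 1) (ih (i + 1) (by lia) _ (AEAll_ker f hf h))
      (AEVan_of_projective _ _ _)

lemma eval_surj (hn : ∀ (M : Type u) [AddCommGroup M] [Module A M] [Module.Finite A M],
    AEAll A M → AEAll A (Module.Dual A M)) (M : Type u) [AddCommGroup M]
      [Module A M] [Module.Finite A M] (h : AEAll A M) :
      Function.Surjective (Module.Dual.eval A M) := by
  obtain ⟨m, f, hf⟩ := Module.Finite.exists_fin' A M
  obtain ⟨h1, h2, h3⟩ := dual_exact f hf h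
  intro φ
  obtain ⟨ψ, hψ⟩ := AEVan_extend _ _ h1 h2 h3 (hn _ (AEAll_ker f hf h) 0) φ
  obtain ⟨x, rfl⟩ := (Module.bijective_dual_eval A (Fin m → A)).2 ψ
  refine ⟨f x, ?_⟩
  rw [← hψ]
  rfl

lemma eval_inj (hn : ∀ (M : Type u) [AddCommGroup M] [Module A M] [Module.Finite A M],
    AEAll A M → AEAll A (Module.Dual A M)) (M : Type u) [AddCommGroup M]
      [Module A M] [Module.Finite A M] (h : AEAll A M) :
      Function.Injective (Module.Dual.eval A M) := by
  obtain ⟨m, f, hf⟩ := Module.Finite.exists_fin' A M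
  obtain ⟨h1, h2, h3⟩ := dual_exact f hf h
  rw [injective_iff_map_eq_zero]
  intro y hy
  obtain ⟨x, rfl⟩ := hf y
  have hx : LinearMap.range f.dualMap ≤ LinearMap.ker (Module.Dual.eval A _ x) := by
    rintro _ ⟨ψ, rfl⟩
    exact LinearMap.congr_fun hy ψ
  rw [← h3.linearMap_ker_eq] at hx
  -- factor through the dual of the kernel
  let S := (LinearMap.ker f).subtype.dualMap
  let θ : Module.Dual A (Module.Dual A (LinearMap.ker f)) :=
    (LinearMap.ker S).liftQ (Module.Dual.eval A _ x) hx ∘ₗ (S.quotKerEquivOfSurjective h2).symm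
  obtain ⟨z, hz⟩ := eval_surj hn _ (AEAll_ker f hf h) θ
  have key : Module.Dual.eval A _ x = Module.Dual.eval A (Fin m → A) z.1 := by
    ext1 ψ
    have h5 : (S.quotKerEquivOfSurjective h2).symm (S ψ) = Submodule.Quotient.mk ψ := by
      rw [LinearEquiv.symm_apply_eq]; rfl
    have h4 : θ (S ψ) = ψ x := by
      simp [θ, h5]
    rw [← hz] at h4
    exact h4.symm
  have := (Module.bijective_dual_eval A (Fin m → A)).1 key
  rw [this]
  exact z.2

lemma GDimZero_of_AEAll (n : ℕ) (hn : ∀ (M : Type u) [AddCommGroup M] [Module A M] (i : ℕ),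
    n ≤ i → AEVan A M (i + 1)) (M : Type u) [AddCommGroup M]
      [Module A M] [Module.Finite A M] (h : AEAll A M) : GDimZero A M := by
  have hd : ∀ (M : Type u) [AddCommGroup M] [Module A M] [Module.Finite A M],
      AEAll A M → AEAll A (Module.Dual A M) := fun M _ _ _ h i =>
    AEVan_dual_of_ge n hn n i (by lia) M h
  refine ⟨⟨eval_inj hd M h, eval_surj hd M h⟩, ?_, ?_⟩
  · intro i hi
    obtain ⟨i, rfl⟩ := Nat.exists_eq_succ_of_ne_zero hi.ne'
    exact extVanish_of_AEVan A M i (h i)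
  · intro i hi
    obtain ⟨i, rfl⟩ := Nat.exists_eq_succ_of_ne_zero hi.ne'
    exact extVanish_of_AEVan A _ i (hd M h i)

lemma GDimLE_of (n : ℕ) (hn : ∀ (M : Type u) [AddCommGroup M] [Module A M] (i : ℕ),
    n ≤ i → AEVan A M (i + 1)) (k : ℕ) : ∀ (M : Type u) [AddCommGroup M]
      [Module A M] [Module.Finite A M] (_ : ∀ i, k ≤ i → AEVan A M (i + 1)), GDimLE A k M := by
  induction k with
  | zero => intro M _ _ _ h; exact GDimZero_of_AEAll n hn M (fun i => h i (by lia))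
  | succ k ih =>
    intro M _ _ _ h
    obtain ⟨m, f, hf⟩ := Module.Finite.exists_fin' A M
    refine ⟨Fin m → A, inferInstance, inferInstance,
      GDimZero_of_AEAll n hn _ (AEVan_of_projective A _), f, hf, ih _ fun i hi => ?_⟩
    exact AEVan_ker (LinearMap.ker f).subtype f (Submodule.subtype_injective _) hf
      (LinearMap.exact_subtype_ker_map f) (i + 1) (h _ (by lia)) (AEVan_of_projective A _ i)

lemma GDim_main (hA : IsGorensteinLocalRing A) (M : Type u) [AddCommGroup M]
      [Module A M] [Module.Finite A M] : ∃ n, GDimLE A n M := by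
  obtain ⟨-, -, n, h⟩ := hA
  have := hasInj_of_InjDimLE A n A h
  have hn : ∀ (M : Type u) [AddCommGroup M] [Module A M] (i : ℕ),
    n ≤ i → AEVan A M (i + 1) := fun M _ _ i hi x =>
      x.eq_zero_of_hasInjectiveDimensionLT (n + 1) (by lia)
  exact ⟨n, GDimLE_of n hn n M (fun i hi => hn M i hi)⟩
end
end GDimPart

section TorPart
open MonoidalCategory

lemma flat_of_tensor_exact {A : Type u} [CommRing A] {P₃ P₂ P₁ Z : Type u}
    [AddCommGroup P₃] [AddCommGroup P₂] [AddCommGroup P₁] [AddCommGroup Z]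
    [Module A P₃] [Module A P₂] [Module A P₁] [Module A Z] [Module.Flat A P₁]
    (d : P₃ →ₗ[A] P₂) (e : P₂ →ₗ[A] P₁) (f : P₁ →ₗ[A] Z) (hde : e ∘ₗ d = 0)
    (hf : Function.Surjective f) (hef : Function.Exact e f)
    (h : ∀ I : Ideal A, Function.Exact (d.lTensor (A ⧸ I)) (e.lTensor (A ⧸ I))) :
    Module.Flat A Z := by
  rw [Module.Flat.iff_rTensor_injective']
  intro I
  rw [injective_iff_map_eq_zero]
  intro z hz
  have comm : ∀ {X Y X' Y' : Type u} [AddCommGroup X] [AddCommGroup Y] [AddCommGroup X']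
      [AddCommGroup Y'] [Module A X] [Module A Y] [Module A X'] [Module A Y']
      (a : X →ₗ[A] Y) (b : X' →ₗ[A] Y') (t : TensorProduct A X X'),
      b.lTensor Y (a.rTensor X' t) = a.rTensor Y' (b.lTensor X t) := by
    intro X Y X' Y' _ _ _ _ _ _ _ _ a b t
    rw [← LinearMap.comp_apply, ← LinearMap.comp_apply, LinearMap.lTensor_comp_rTensor,
      LinearMap.rTensor_comp_lTensor]
  obtain ⟨y, rfl⟩ := LinearMap.lTensor_surjective I hf z
  rw [← comm] at hz
  obtain ⟨w, hw⟩ := (lTensor_exact A hef hf _).1 hz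
  have hq : Function.Exact I.subtype (Submodule.mkQ I) := LinearMap.exact_subtype_mkQ I
  have hqs : Function.Surjective (Submodule.mkQ I) := Submodule.mkQ_surjective I
  have h1 : e.lTensor (A ⧸ I) ((Submodule.mkQ I).rTensor P₂ w) = 0 := by
    rw [comm, hw]
    exact (rTensor_exact P₁ hq hqs _).2 ⟨y, rfl⟩
  obtain ⟨v', hv'⟩ := (h I _).1 h1
  obtain ⟨v, rfl⟩ := LinearMap.rTensor_surjective P₃ hqs v'
  rw [comm] at hv'
  have h2 : (Submodule.mkQ I).rTensor P₂ (w - d.lTensor A v) = 0 := by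
    rw [map_sub, hv', sub_self]
  obtain ⟨u, hu⟩ := (rTensor_exact P₂ hq hqs _).1 h2
  have h3 : I.subtype.rTensor P₁ (e.lTensor I u) = I.subtype.rTensor P₁ y := by
    rw [← comm, hu, map_sub, hw, ← LinearMap.lTensor_comp_apply, hde]
    simp
  have h4 := Module.Flat.rTensor_preserves_injective_linearMap (M := P₁) I.subtype
    (Submodule.subtype_injective I) h3
  rw [← h4]
  exact (lTensor_exact I hef hf _).2 ⟨u, rfl⟩

variable {A : Type u} [CommRing A] {N : ModuleCat.{u} A} (P : ProjectiveResolution N)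

/-- The complex `L ⊗ P`. -/
noncomputable abbrev TC (L : ModuleCat.{u} A) : ChainComplex (ModuleCat.{u} A) ℕ :=
  (((tensoringLeft (ModuleCat.{u} A)).obj L).mapHomologicalComplex _).obj P.complex

/-- Functoriality of `L ⊗ P` in `L`. -/
noncomputable abbrev TCmap {L L' : ModuleCat.{u} A} (f : L ⟶ L') : TC P L ⟶ TC P L' :=
  (NatTrans.mapHomologicalComplex ((tensoringLeft (ModuleCat.{u} A)).map f) _).app P.complex

lemma flat_X (i : ℕ) : Module.Flat A (P.complex.X i) := by
  have : Module.Projective A (P.complex.X i) :=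
    (IsProjective.iff_projective (P.complex.X i)).2 (P.projective i)
  infer_instance

lemma TCmap_zero {L L' L'' : ModuleCat.{u} A} (f : L ⟶ L') (g : L' ⟶ L'') (h : f ≫ g = 0) :
    TCmap P f ≫ TCmap P g = 0 := by
  ext i : 1
  change ((f ▷ P.complex.X i) ≫ (g ▷ P.complex.X i)) = 0
  rw [← comp_whiskerRight, h, MonoidalPreadditive.zero_whiskerRight]

lemma TC_shortExact {S : ShortComplex (ModuleCat.{u} A)} (hS : S.ShortExact) :
    (ShortComplex.mk (TCmap P S.f) (TCmap P S.g) (TCmap_zero P _ _ S.zero)).ShortExact := by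
  refine HomologicalComplex.shortExact_of_degreewise_shortExact _ fun i => ?_
  have := flat_X P i
  have h2 := (ShortComplex.ShortExact.moduleCat_exact_iff_function_exact _).1 hS.exact
  refine ModuleCat.shortComplex_shortExact _ ?_ ?_ ?_
  · exact Module.Flat.rTensor_exact (P.complex.X i) h2
  · exact Module.Flat.rTensor_preserves_injective_linearMap (M := P.complex.X i) S.f.hom
      hS.moduleCat_injective_f
  · exact LinearMap.rTensor_surjective (P.complex.X i) hS.moduleCat_surjective_g

lemma TC_smul (L : ModuleCat.{u} A) (x : A) (i : ℕ) :
    HomologicalComplex.homologyMap (TCmap P (x • 𝟙 L)) i = x • 𝟙 _ := by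
  have : (HomologicalComplex.shortComplexFunctor (ModuleCat.{u} A) (ComplexShape.down ℕ) i).map
      (TCmap P (x • 𝟙 L)) = x • 𝟙 _ := by
    have key : ∀ j, (x • 𝟙 L) ▷ P.complex.X j = x • 𝟙 (L ⊗ P.complex.X j) := by
      intro j
      rw [MonoidalLinear.smul_whiskerRight, id_whiskerRight]
    ext1
    · exact key _
    · exact key _
    · exact key _
  unfold HomologicalComplex.homologyMap
  rw [this, ShortComplex.homologyMap_smul, ShortComplex.homologyMap_id]
  rfl

lemma TC_exactAt_iff (L : ModuleCat.{u} A) (i : ℕ) :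
    Subsingleton ((TC P L).homology (i + 1)) ↔
      Function.Exact ((P.complex.d (i + 2) (i + 1)).hom.lTensor L)
        ((P.complex.d (i + 1) i).hom.lTensor L) := by
  rw [← ModuleCat.isZero_iff_subsingleton, ← HomologicalComplex.exactAt_iff_isZero_homology,
    HomologicalComplex.exactAt_iff' _ (i + 2) (i + 1) i (by simp) (by simp),
    ShortComplex.ShortExact.moduleCat_exact_iff_function_exact]
  rfl

lemma P_exact (i : ℕ) : Function.Exact (P.complex.d (i + 2) (i + 1)).hom
    (P.complex.d (i + 1) i).hom :=
  (ShortComplex.ShortExact.moduleCat_exact_iff_function_exact _).1 (P.exact_succ i)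

lemma TC_flat (L : ModuleCat.{u} A) [Module.Flat A L] (i : ℕ) :
    Subsingleton ((TC P L).homology (i + 1)) := by
  rw [TC_exactAt_iff]
  exact Module.Flat.lTensor_exact L (P_exact P i)

lemma torVanish_iff (i : ℕ) (M : Type u) [AddCommGroup M] [Module A M]
    (N : Type u) [AddCommGroup N] [Module A N] (P : ProjectiveResolution (ModuleCat.of A N)) :
    TorVanish A i M N ↔ Subsingleton ((TC P (ModuleCat.of A M)).homology i) :=
  (P.isoLeftDerivedObj ((tensoringLeft (ModuleCat.{u} A)).obj (ModuleCat.of A M))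
    i).toLinearEquiv.toEquiv.subsingleton_congr

/-- `x`-adic separatedness. -/
def SepBy (x : A) (X : Type u) [AddCommGroup X] [Module A X] : Prop :=
  ∀ y : X, (∀ n : ℕ, ∃ z : X, y = x ^ n • z) → y = 0

lemma SepBy.of_injective {x : A} {X Y : Type u} [AddCommGroup X] [Module A X] [AddCommGroup Y]
    [Module A Y] (h : SepBy x Y) (f : X →ₗ[A] Y) (hf : Function.Injective f) : SepBy x X := by
  intro y hy
  apply hf
  rw [map_zero]
  refine h _ fun n => ?_
  obtain ⟨z, hz⟩ := hy n
  exact ⟨f z, by rw [hz, map_smul]⟩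

lemma SepBy.subsingleton {x : A} {X : Type u} [AddCommGroup X] [Module A X]
    (h : SepBy x X) (hx : ∀ y : X, ∃ z, y = x • z) : Subsingleton X := by
  refine subsingleton_of_forall_eq 0 fun y => h y fun n => ?_
  induction n with
  | zero => exact ⟨y, by simp⟩
  | succ n ih =>
    obtain ⟨z, hz⟩ := ih
    obtain ⟨w, hw⟩ := hx z
    exact ⟨w, by rw [hz, hw, smul_smul, pow_succ]⟩

lemma SepBy_tensor {A : Type u} [CommRing A] [IsLocalRing A]
    (B : Type u) [CommRing B] [IsLocalRing B] [IsNoetherianRing B] [Algebra A B]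
    (hB : IsLocalHom (algebraMap A B))
    (N : Type u) [AddCommGroup N] [Module A N] [Module B N] [IsScalarTower A B N]
    [Module.Finite B N] (L : Type u) [AddCommGroup L] [Module A L] [Module.Finite A L]
    (x : A) (hx : x ∈ maximalIdeal A) : SepBy x (TensorProduct A L N) := by
  refine SepBy.of_injective (Y := TensorProduct A N L) ?_ (TensorProduct.comm A L N).toLinearMap
    (TensorProduct.comm A L N).injective
  obtain ⟨m, f, hf⟩ := Module.Finite.exists_fin' A L
  have : Module.Finite B (TensorProduct A N (Fin m → A)) :=
    Module.Finite.equiv (TensorProduct.piScalarRight A B N (Fin m)).symm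
  have : Module.Finite B (TensorProduct A N L) :=
    Module.Finite.of_surjective (TensorProduct.AlgebraTensorModule.map
      (LinearMap.id : N →ₗ[B] N) f) (LinearMap.lTensor_surjective N hf)
  intro y hy
  have hne : maximalIdeal B ≠ ⊤ := (maximalIdeal.isMaximal B).ne_top
  have hk := Ideal.iInf_pow_smul_eq_bot_of_isLocalRing (M := TensorProduct A N L) _ hne
  have : y ∈ (⨅ i : ℕ, maximalIdeal B ^ i • ⊤ : Submodule B (TensorProduct A N L)) := by
    rw [Submodule.mem_iInf]
    intro n
    obtain ⟨z, rfl⟩ := hy n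
    have hxz : x ^ n • z = (algebraMap A B x) ^ n • z := by
      rw [← map_pow, algebraMap_smul]
    rw [hxz]
    refine Submodule.smul_mem_smul (Ideal.pow_mem_pow ?_ n) Submodule.mem_top
    rw [mem_maximalIdeal, mem_nonunits_iff] at hx ⊢
    exact fun h => hx (hB.map_nonunit x h)
  rw [hk] at this
  simpa using this

lemma TC_zero_sep {A : Type u} [CommRing A] [IsLocalRing A] [IsNoetherianRing A]
    (B : Type u) [CommRing B] [IsLocalRing B] [IsNoetherianRing B] [Algebra A B]
    (hB : IsLocalHom (algebraMap A B))
    (N : Type u) [AddCommGroup N] [Module A N] [Module B N] [IsScalarTower A B N]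
    [Module.Finite B N] (P : ProjectiveResolution (ModuleCat.of A N))
    (x : A) (hx : x ∈ maximalIdeal A) (i : ℕ) : ∀ (L : Type u) [AddCommGroup L] [Module A L]
    [Module.Finite A L], SepBy x ((TC P (ModuleCat.of A L)).homology i) := by
  induction i with
  | zero =>
    intro L _ _ _
    let F := (tensoringLeft (ModuleCat.{u} A)).obj (ModuleCat.of A L)
    have : Limits.PreservesFiniteColimits F :=
      inferInstanceAs (Limits.PreservesFiniteColimits (tensorLeft (ModuleCat.of A L)))
    let e := ((P.isoLeftDerivedObj F 0).symm ≪≫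
      F.leftDerivedZeroIsoSelf.app (ModuleCat.of A N)).toLinearEquiv
    exact SepBy.of_injective (Y := TensorProduct A L N) (SepBy_tensor B hB N L x hx)
      e.toLinearMap e.injective
  | succ i ih =>
    intro L _ _ _
    obtain ⟨m, f, hf⟩ := Module.Finite.exists_fin' A L
    have hS := TC_shortExact P (gd_shortExact (LinearMap.ker f).subtype f
      (Submodule.subtype_injective _) hf (LinearMap.exact_subtype_ker_map f))
    have h3 := (ShortComplex.ShortExact.moduleCat_exact_iff_function_exact _).1
      (hS.homology_exact₃ (i + 1) i (by simp))
    have h0 : Subsingleton ((TC P (ModuleCat.of A (Fin m → A))).homology (i + 1)) := by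
      have : Module.Flat A (ModuleCat.of A (Fin m → A)) :=
        inferInstanceAs (Module.Flat A (Fin m → A))
      exact TC_flat P _ i
    refine SepBy.of_injective (ih (LinearMap.ker f)) (hS.δ (i + 1) i (by simp)).hom ?_
    rw [injective_iff_map_eq_zero]
    intro y hy
    obtain ⟨z, hz⟩ := (h3 y).1 hy
    rw [← hz, @Subsingleton.elim _ h0 z 0]
    exact map_zero _

section LES
variable {L₁ L₂ L₃ : Type u} [AddCommGroup L₁]
    [AddCommGroup L₂] [AddCommGroup L₃] [Module A L₁] [Module A L₂] [Module A L₃]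

lemma TC_surj
    (g : L₁ →ₗ[A] L₂) (f : L₂ →ₗ[A] L₃) (hg : Function.Injective g) (hf : Function.Surjective f)
    (h : Function.Exact g f)
    (i : ℕ) (h₃ : Subsingleton ((TC P (ModuleCat.of A L₃)).homology i)) :
    Function.Surjective (HomologicalComplex.homologyMap (TCmap P (ModuleCat.ofHom g)) i).hom := by
  have hS := TC_shortExact P (gd_shortExact g f hg hf h)
  have h2 := (ShortComplex.ShortExact.moduleCat_exact_iff_function_exact _).1 (hS.homology_exact₂ i)
  intro y
  exact (h2 y).1 (@Subsingleton.elim _ h₃ _ _)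

lemma TC_mid
    (g : L₁ →ₗ[A] L₂) (f : L₂ →ₗ[A] L₃) (hg : Function.Injective g) (hf : Function.Surjective f)
    (h : Function.Exact g f)
    (i : ℕ) (h₃ : Subsingleton ((TC P (ModuleCat.of A L₃)).homology i))
    (h₁ : Subsingleton ((TC P (ModuleCat.of A L₁)).homology i)) :
    Subsingleton ((TC P (ModuleCat.of A L₂)).homology i) :=
  (TC_surj P g f hg hf h i h₃).subsingleton
end LES

lemma TC_all {A : Type u} [CommRing A] [IsLocalRing A] [IsNoetherianRing A]
    (B : Type u) [CommRing B] [IsLocalRing B] [IsNoetherianRing B] [Algebra A B]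
    (hB : IsLocalHom (algebraMap A B))
    (N : Type u) [AddCommGroup N] [Module A N] [Module B N] [IsScalarTower A B N]
    [Module.Finite B N] (P : ProjectiveResolution (ModuleCat.of A N)) (i : ℕ)
    (hk : Subsingleton ((TC P (ModuleCat.of A (ResidueField A))).homology (i + 1))) :
    ∀ (I : Ideal A), Subsingleton ((TC P (ModuleCat.of A (A ⧸ I))).homology (i + 1)) := by
  intro I
  induction I using IsNoetherian.induction with
  | hgt I ih =>
  by_cases htop : I = ⊤
  · have : Module.Flat A (ModuleCat.of A (A ⧸ I)) := by
      have : Subsingleton (A ⧸ I) := Ideal.Quotient.subsingleton_iff.2 htop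
      exact inferInstanceAs (Module.Flat A (A ⧸ I))
    exact TC_flat P _ i
  by_cases hmax : maximalIdeal A ≤ I
  · obtain rfl : maximalIdeal A = I := (maximalIdeal.isMaximal A).eq_of_le htop hmax
    exact hk
  obtain ⟨x, hx, hxI⟩ := Set.not_subset.1 hmax
  -- multiplication by `x`
  let m : A →ₗ[A] A ⧸ I := LinearMap.toSpanSingleton A (A ⧸ I) (Submodule.Quotient.mk x)
  let J : Ideal A := LinearMap.ker m
  have hm : ∀ a, m a = Submodule.Quotient.mk (a * x) := fun a => rfl
  have hJ : ∀ a, a ∈ J ↔ a * x ∈ I := fun a => by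
    rw [LinearMap.mem_ker, hm, Submodule.Quotient.mk_eq_zero]
  have hIJ : I ≤ J := fun a ha => (hJ a).2 (Ideal.mul_mem_right x I ha)
  let K : Ideal A := I ⊔ Ideal.span {x}
  have hIK : I ≤ K := le_sup_left
  have hIK' : I < K := lt_of_le_of_ne hIK fun h => hxI (h ▸ (le_sup_right : _ ≤ K)
    (Ideal.mem_span_singleton_self x))
  let g : (A ⧸ J) →ₗ[A] A ⧸ I := J.liftQ m le_rfl
  have hg : Function.Injective g := LinearMap.ker_eq_bot.1 (Submodule.ker_liftQ_eq_bot' _ _ rfl)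
  let f : (A ⧸ I) →ₗ[A] A ⧸ K := Submodule.factor hIK
  have hf : Function.Surjective f := Submodule.factor_surjective hIK
  have hgf : Function.Exact g f := by
    intro y
    obtain ⟨y, rfl⟩ := Submodule.Quotient.mk_surjective _ y
    constructor
    · intro hy
      have hy : y ∈ K := (Submodule.Quotient.mk_eq_zero K).1 hy
      obtain ⟨a, ha, b, hb, rfl⟩ := Submodule.mem_sup.1 hy
      obtain ⟨c, rfl⟩ := Ideal.mem_span_singleton'.1 hb
      refine ⟨Submodule.Quotient.mk c, ?_⟩
      change (Submodule.Quotient.mk (c * x) : A ⧸ I) = _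
      rw [Submodule.Quotient.eq]
      simpa using ha
    · rintro ⟨z, hz⟩
      obtain ⟨z, rfl⟩ := Submodule.Quotient.mk_surjective _ z
      rw [← hz]
      change (Submodule.Quotient.mk (z * x) : A ⧸ K) = 0
      rw [Submodule.Quotient.mk_eq_zero]
      exact Ideal.mul_mem_left K _ ((le_sup_right : _ ≤ K) (Ideal.mem_span_singleton_self x))
  rcases hIJ.lt_or_eq with hlt | heq
  · exact TC_mid P g f hg hf hgf (i + 1) (ih K hIK') (ih J hlt)
  · -- Nakayama / Krull
    let g' : (A ⧸ I) →ₗ[A] A ⧸ I := g ∘ₗ (Submodule.quotEquivOfEq I J heq).toLinearMap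
    have hg' : Function.Injective g' := hg.comp (Submodule.quotEquivOfEq I J heq).injective
    have hgf' : Function.Exact g' f := by
      intro y
      rw [hgf y]
      constructor
      · rintro ⟨z, rfl⟩
        obtain ⟨w, rfl⟩ := (Submodule.quotEquivOfEq I J heq).surjective z
        exact ⟨w, rfl⟩
      · rintro ⟨z, rfl⟩
        exact ⟨_, rfl⟩
    have hgx : ModuleCat.ofHom g' = x • 𝟙 (ModuleCat.of A (A ⧸ I)) := by
      ext1
      refine LinearMap.ext fun y => ?_
      obtain ⟨y, rfl⟩ := Submodule.Quotient.mk_surjective _ y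
      change (Submodule.Quotient.mk (y * x) : A ⧸ I) = x • Submodule.Quotient.mk y
      rw [mul_comm]; rfl
    refine SepBy.subsingleton (TC_zero_sep B hB N P x hx (i + 1) (A ⧸ I)) fun y => ?_
    obtain ⟨z, hz⟩ := TC_surj P g' f hg' hf hgf' (i + 1) (ih K hIK') y
    rw [hgx, TC_smul] at hz
    exact ⟨z, hz.symm⟩

lemma flatDim_ker (k : ℕ) : ∀ j : ℕ, Module.Flat A
    (LinearMap.ker (P.complex.d (j + k + 1) (j + k)).hom) →
    FlatDimLE A k (LinearMap.ker (P.complex.d (j + 1) j).hom) := by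
  induction k with
  | zero => intro j h; exact h
  | succ k ih =>
    intro j h
    have hex := P_exact P j
    let f := (P.complex.d (j + 2) (j + 1)).hom.codRestrict
      (LinearMap.ker (P.complex.d (j + 1) j).hom) (fun x => (hex _).2 ⟨x, rfl⟩)
    refine ⟨P.complex.X (j + 2), inferInstance, inferInstance, flat_X P _, f, ?_, ?_⟩
    · rintro ⟨y, hy⟩
      obtain ⟨z, rfl⟩ := (hex y).1 hy
      exact ⟨z, rfl⟩
    · have hk : LinearMap.ker f = LinearMap.ker (P.complex.d (j + 1 + 1) (j + 1)).hom :=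
        LinearMap.ker_codRestrict _ _ _
      rw [hk]
      refine ih (j + 1) ?_
      rw [show j + 1 + k = j + (k + 1) by lia]
      exact h

lemma flatDim_of (k : ℕ) (h : Module.Flat A
    (LinearMap.ker (P.complex.d (k + 1) k).hom)) :
    FlatDimLE A (k + 2) N := by
  let p : P.complex.X 0 →ₗ[A] N := (P.π.f 0).hom
  have h0 : Function.Exact (P.complex.d 1 0).hom p :=
    (ShortComplex.ShortExact.moduleCat_exact_iff_function_exact _).1 P.exact₀
  refine ⟨P.complex.X 0, inferInstance, inferInstance, flat_X P _, p, ?_, ?_⟩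
  · exact (ModuleCat.epi_iff_surjective (P.π.f 0)).1 inferInstance
  · let f := (P.complex.d 1 0).hom.codRestrict
      (LinearMap.ker p) (fun x => (h0 _).2 ⟨x, rfl⟩)
    refine ⟨P.complex.X 1, inferInstance, inferInstance, flat_X P _, f, ?_, ?_⟩
    · rintro ⟨y, hy⟩
      obtain ⟨z, rfl⟩ := (h0 y).1 hy
      exact ⟨z, rfl⟩
    · have hk : LinearMap.ker f = LinearMap.ker (P.complex.d (0 + 1) 0).hom :=
        LinearMap.ker_codRestrict _ _ _
      rw [hk]
      refine flatDim_ker P k 0 ?_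
      rw [zero_add]
      exact h

lemma isTestModule_residueField (A : Type u) [CommRing A] [IsLocalRing A] [IsNoetherianRing A] :
    IsTestModule A (ResidueField A) := by
  intro B _ _ _ _ hB N _ _ _ _ hN ⟨i₀, hi⟩
  let P := projectiveResolution (ModuleCat.of A N)
  have hk := (torVanish_iff (i₀ + 2 + 1) (ResidueField A) N P).1 (hi _ (by lia))
  have hall := TC_all B hB N P (i₀ + 2) hk
  refine ⟨i₀ + 2, flatDim_of P i₀ ?_⟩
  have hex := P_exact P i₀
  have hex' := P_exact P (i₀ + 1)
  let f := (P.complex.d (i₀ + 2) (i₀ + 1)).hom.codRestrict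
      (LinearMap.ker (P.complex.d (i₀ + 1) i₀).hom) (fun x => (hex _).2 ⟨x, rfl⟩)
  have := flat_X P (i₀ + 2)
  refine flat_of_tensor_exact (P.complex.d (i₀ + 4) (i₀ + 3)).hom
    (P.complex.d (i₀ + 3) (i₀ + 2)).hom f ?_ ?_ ?_ ?_
  · exact (P_exact P (i₀ + 2)).linearMap_comp_eq_zero
  · rintro ⟨y, hy⟩
    obtain ⟨z, rfl⟩ := (hex y).1 hy
    exact ⟨z, rfl⟩
  · intro y
    rw [← hex' y]
    exact Subtype.ext_iff
  · intro I
    exact (TC_exactAt_iff P (ModuleCat.of A (A ⧸ I)) (i₀ + 2)).1 (hall I)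

end TorPart


/-- If `A` is a Gorenstein noetherian local ring, then there exists a
test module for `A` of finite Gorenstein dimension; in particular, the residue field `k`
is such a module. -/
theorem exists_test_module_of_finite_G_dim_of_gorenstein
    (A : Type u) [CommRing A] [IsLocalRing A] [IsNoetherianRing A]
    (hA : IsGorensteinLocalRing A) :
    (∃ (M : Type u) (_ : AddCommGroup M) (_ : Module A M),
        Module.Finite A M ∧ IsTestModule A M ∧ ∃ n : ℕ, GDimLE A n M) ∧
      IsTestModule A (ResidueField A) ∧ ∃ n : ℕ, GDimLE A n (ResidueField A) := by
  have hk := isTestModule_residueField A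
  have hfin : Module.Finite A (ResidueField A) :=
    Module.Finite.of_surjective (Algebra.linearMap A (ResidueField A)) residue_surjective
  have hg := GDim_main hA (ResidueField A)
  exact ⟨⟨ResidueField A, inferInstance, inferInstance, hfin, hk, hg⟩, hk, hg⟩
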